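/- arXiv:1701.01628 — 2 statements merged into one kernel-verified Lean document; each statement's English description precedes it below -/
import Mathlib

section
/- Every symmetrized joint channel W_{a,b} (successive form, D-value representation, with involution y_a ↦ ȳ_a) admits a decoupling decomposition: there exists a family of binary-input channels W_2(·|·;y_a,u_a) on the set of occurring b-channel D-values such that W_b(y_a,u_a,d_b|u_b) = (1/2)·W_a(y_a|u_a)·W_2(d_b|u_b;y_a,u_a) for all y_a,u_a,d_b,u_b; moreover, for every (y_a,u_a), W_2(·|·;y_a,u_a) is a BMS channel satisfying W_2(d_b|u_b;y_a,u_a) = W_2(−d_b|1−u_b;y_a,u_a), and the family satisfies W_2(d_b|u_b;y_a,u_a) = W_2(d_b|u_b;ȳ_a,1−u_a). -/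
open Finset

/-- `W y u` is the probability that the channel outputs `y` given input `u`. -/
def IsChannel {Y U : Type*} [Fintype Y] (W : Y → U → ℝ) : Prop :=
  (∀ y u, 0 ≤ W y u) ∧ ∀ u, ∑ y, W y u = 1

/-- A randomized decoder: `φ y u` is the probability of declaring `u` upon observing `y`. -/
def IsDecoder {Y : Type*} (φ : Y → Bool → ℝ) : Prop :=
  (∀ y u, 0 ≤ φ y u) ∧ ∀ y, ∑ u, φ y u = 1

/-- A joint channel with two binary inputs and outputs in `Ya × Yb`. -/
def IsJointChannel {Ya Yb : Type*} [Fintype Ya] [Fintype Yb]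
    (W : Ya → Yb → Bool → Bool → ℝ) : Prop :=
  (∀ ya yb ua ub, 0 ≤ W ya yb ua ub) ∧ ∀ ua ub, ∑ ya, ∑ yb, W ya yb ua ub = 1

/-- a-channel marginal of a joint channel (inputs equiprobable). -/
noncomputable def margA {Ya Yb : Type*} [Fintype Ya] [Fintype Yb]
    (W : Ya → Yb → Bool → Bool → ℝ) (ya : Ya) (ua : Bool) : ℝ :=
  (1 / 2) * ∑ ub, ∑ yb, W ya yb ua ub

/-- b-channel marginal of a joint channel (inputs equiprobable). -/
noncomputable def margB {Ya Yb : Type*} [Fintype Ya] [Fintype Yb]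
    (W : Ya → Yb → Bool → Bool → ℝ) (yb : Yb) (ub : Bool) : ℝ :=
  (1 / 2) * ∑ ua, ∑ ya, W ya yb ua ub

/-- `P(E_a ∪ E_b)`: the probability that at least one of the two decoders errs. -/
noncomputable def PerrUnion {Ya Yb : Type*} [Fintype Ya] [Fintype Yb]
    (W : Ya → Yb → Bool → Bool → ℝ)
    (φa : Ya → Bool → ℝ) (φb : Yb → Bool → ℝ) : ℝ :=
  1 - (1 / 4) * ∑ ua, ∑ ub, ∑ ya, ∑ yb, W ya yb ua ub * φa ya ua * φb yb ub

/-- Successive form: the b-output is `(y_a, u_a, y_r)` with probability one. -/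
def SuccessiveForm {Ya Yr : Type*} [Fintype Ya] [Fintype Yr] [DecidableEq Ya]
    (W : Ya → Ya × Bool × Yr → Bool → Bool → ℝ) : Prop :=
  ∀ ya ya' ua' yr ua ub,
    W ya (ya', ua', yr) ua ub =
      if ya' = ya ∧ ua' = ua then 2 * margB W (ya, ua, yr) ub else 0

/-- A maximum-likelihood decoder for the binary-input channel `V`. -/
def IsMLDecoder {Y : Type*} (V : Y → Bool → ℝ) (φ : Y → Bool → ℝ) : Prop :=
  ∀ y u, 0 < φ y u → V y u = max (V y false) (V y true)

/-- `W` is stochastically degraded from `Q`. -/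
def Degraded {Y Z U : Type*} [Fintype Y] [Fintype Z]
    (W : Y → U → ℝ) (Q : Z → U → ℝ) : Prop :=
  ∃ P : Z → Y → ℝ,
    (∀ z y, 0 ≤ P z y) ∧ (∀ z, ∑ y, P z y = 1) ∧
    ∀ y u, W y u = ∑ z, P z y * Q z u

/-- `Q` is properly upgraded from `W` (both joint channels in successive form). -/
def ProperUpgrade {Ya Yr Za Zr : Type*}
    [Fintype Ya] [Fintype Yr] [Fintype Za] [Fintype Zr]
    (Q : Za → Za × Bool × Zr → Bool → Bool → ℝ)
    (W : Ya → Ya × Bool × Yr → Bool → Bool → ℝ) : Prop :=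
  ∃ (Pa : Za → Ya → ℝ) (Pb : Za → Bool → Zr → Ya → Yr → ℝ),
    (∀ za ya, 0 ≤ Pa za ya) ∧ (∀ za, ∑ ya, Pa za ya = 1) ∧
    (∀ za ua zr ya yr, 0 ≤ Pb za ua zr ya yr) ∧
    (∀ za ua zr ya, ∑ yr, Pb za ua zr ya yr = 1) ∧
    ∀ ya ua yr ub,
      margB W (ya, ua, yr) ub =
        ∑ za, ∑ zr, Pa za ya * Pb za ua zr ya yr * margB Q (za, ua, zr) ub

/-- The minimum over decoder pairs of `P(E_a ∪ E_b)`. -/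
noncomputable def PeIMJP {Ya Yb : Type*} [Fintype Ya] [Fintype Yb]
    (W : Ya → Yb → Bool → Bool → ℝ) : ℝ :=
  sInf {p : ℝ | ∃ φa φb, IsDecoder φa ∧ IsDecoder φb ∧ p = PerrUnion W φa φb}

/-- Error probability of an ML decoder for a binary-input channel with equiprobable inputs. -/
noncomputable def PeML {Y : Type*} [Fintype Y] (V : Y → Bool → ℝ) : ℝ :=
  1 - (1 / 2) * ∑ y, max (V y false) (V y true)

/-- The `D`-value of an output of a binary-input channel. -/
noncomputable def dval {Y : Type*} (V : Y → Bool → ℝ) (y : Y) : ℝ :=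
  (V y false - V y true) / (V y false + V y true)

/-- D-value representation: the third component of each positive-probability b-output
is its b-channel D-value (`v` gives the real value of a rest symbol). -/
def DvalRepJoint {Ya R : Type*} [Fintype Ya] [Fintype R]
    (W : Ya → Ya × Bool × R → Bool → Bool → ℝ) (v : R → ℝ) : Prop :=
  ∀ ya ua r,
    0 < margB W (ya, ua, r) false + margB W (ya, ua, r) true →
    v r = dval (margB W) (ya, ua, r)

/-- A symmetrized joint channel (successive form, D-value representation). -/
def SymmetrizedJoint {Ya R : Type*} [Fintype Ya] [Fintype R]
    (W : Ya → Ya × Bool × R → Bool → Bool → ℝ)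
    (v : R → ℝ) (bar : Ya → Ya) (neg : R → R) : Prop :=
  Function.Involutive bar ∧ Function.Involutive neg ∧
  (∀ r, v (neg r) = -v r) ∧
  (∀ ya ua, margA W ya ua = margA W (bar ya) (!ua)) ∧
  (∀ ya ua r ub,
    margB W (ya, ua, r) ub = margB W (bar ya, !ua, r) ub ∧
    margB W (ya, ua, r) ub = margB W (ya, ua, neg r) (!ub) ∧
    margB W (ya, ua, r) ub = margB W (bar ya, !ua, neg r) (!ub))

/-- A decoupling decomposition `W_b = (1/2)·W_a·W_2` of a symmetrized joint channel. -/
def DecouplingDecomp {Ya R : Type*} [Fintype Ya] [Fintype R]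
    (W : Ya → Ya × Bool × R → Bool → Bool → ℝ)
    (W2 : R → Bool → Ya → Bool → ℝ) : Prop :=
  (∀ r ub ya ua, 0 ≤ W2 r ub ya ua) ∧
  (∀ ya ua ub, ∑ r, W2 r ub ya ua = 1) ∧
  ∀ ya ua r ub, margB W (ya, ua, r) ub = (1 / 2) * margA W ya ua * W2 r ub ya ua

theorem margB_nonneg {Ya Yb : Type*} [Fintype Ya] [Fintype Yb]
    {W : Ya → Yb → Bool → Bool → ℝ} (hW : IsJointChannel W) (yb : Yb) (ub : Bool) :
    0 ≤ margB W yb ub :=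
  mul_nonneg (by norm_num)
    (sum_nonneg fun _ _ => sum_nonneg fun _ _ => hW.1 _ _ _ _)

/-- In successive form, the a-channel is obtained by summing out the rest symbol and `u_b`. -/
theorem SuccessiveForm.margA_eq {Ya R : Type*} [Fintype Ya] [Fintype R] [DecidableEq Ya]
    {W : Ya → Ya × Bool × R → Bool → Bool → ℝ} (hsucc : SuccessiveForm W)
    (ya : Ya) (ua : Bool) :
    margA W ya ua = ∑ ub, ∑ r, margB W (ya, ua, r) ub := by
  have h (ub : Bool) : ∑ yb, W ya yb ua ub = 2 * ∑ r, margB W (ya, ua, r) ub := by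
    rw [Fintype.sum_prod_type, Fintype.sum_eq_single ya, Fintype.sum_prod_type,
      Fintype.sum_eq_single ua, mul_sum]
    · exact sum_congr rfl fun r _ => by rw [hsucc, if_pos ⟨rfl, rfl⟩]
    · exact fun ua' hua => sum_eq_zero fun r _ => by
        rw [hsucc, if_neg fun hc => hua hc.2]
    · exact fun ya' hya => sum_eq_zero fun p _ => by
        rw [hsucc, if_neg fun hc => hya hc.1]
  simp only [margA, h, ← mul_sum]
  ring

/-- For a symmetrized joint channel, the rest symbol carries half of the a-channel mass,
whatever `u_b` is. -/
theorem SymmetrizedJoint.sum_margB {Ya R : Type*} [Fintype Ya] [Fintype R] [DecidableEq Ya]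
    {W : Ya → Ya × Bool × R → Bool → Bool → ℝ} {v : R → ℝ} {bar : Ya → Ya} {neg : R → R}
    (hsym : SymmetrizedJoint W v bar neg) (hsucc : SuccessiveForm W)
    (ya : Ya) (ua ub : Bool) :
    ∑ r, margB W (ya, ua, r) ub = margA W ya ua / 2 := by
  obtain ⟨-, hneg, -, -, hB⟩ := hsym
  have hflip : ∑ r, margB W (ya, ua, r) true = ∑ r, margB W (ya, ua, r) false :=
    Fintype.sum_equiv hneg.toPerm _ _ fun r => (hB ya ua r true).2.1
  rw [hsucc.margA_eq, Fintype.sum_bool, hflip]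
  cases ub
  · ring
  · rw [hflip]
    ring

theorem IsJointChannel.nonempty_rest {Ya R : Type*} [Fintype Ya] [Fintype R]
    {W : Ya → Ya × Bool × R → Bool → Bool → ℝ} (hW : IsJointChannel W) : Nonempty R := by
  by_contra hR
  rw [not_nonempty_iff] at hR
  simpa using hW.2 false false


/-- Every symmetrized joint channel (successive form, D-value
representation) admits a decoupling decomposition `W_b = (1/2)·W_a·W_2`, where each
`W_2(·|·;y_a,u_a)` is a BMS channel on the rest alphabet satisfying
`W_2(d_b|u_b) = W_2(−d_b|1−u_b)`, and `W_2(·|·;y_a,u_a) = W_2(·|·;ȳ_a,1−u_a)`. -/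
theorem stmt12 {Ya R : Type*} [Fintype Ya] [Fintype R] [DecidableEq Ya]
    (W : Ya → Ya × Bool × R → Bool → Bool → ℝ) (v : R → ℝ)
    (bar : Ya → Ya) (neg : R → R)
    (hW : IsJointChannel W) (hsucc : SuccessiveForm W)
    (hrep : DvalRepJoint W v)
    (hsym : SymmetrizedJoint W v bar neg) :
    ∃ W2 : R → Bool → Ya → Bool → ℝ,
      (∀ r ub ya ua, 0 ≤ W2 r ub ya ua) ∧
      (∀ ya ua ub, ∑ r, W2 r ub ya ua = 1) ∧
      (∀ ya ua r ub,
        margB W (ya, ua, r) ub = (1 / 2) * margA W ya ua * W2 r ub ya ua) ∧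
      (∀ ya ua r ub, W2 (neg r) (!ub) ya ua = W2 r ub ya ua) ∧
      (∀ ya ua r ub, W2 r ub (bar ya) (!ua) = W2 r ub ya ua) := by
  have hsum := hsym.sum_margB hsucc
  have hpos := margB_nonneg hW
  have hA_nonneg (ya ua) : 0 ≤ margA W ya ua := by
    linarith [hsum ya ua false, sum_nonneg fun r (_ : r ∈ univ) => hpos (ya, ua, r) false]
  have hcard : (Fintype.card R : ℝ) ≠ 0 := by
    have := hW.nonempty_rest
    exact_mod_cast Fintype.card_ne_zero
  obtain ⟨-, -, -, hA, hB⟩ := hsym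
  refine ⟨fun r ub ya ua => if margA W ya ua = 0 then 1 / Fintype.card R
    else 2 * margB W (ya, ua, r) ub / margA W ya ua, ?_, ?_, ?_, ?_, ?_⟩
  · intro r ub ya ua
    dsimp only
    split_ifs
    · positivity
    · exact div_nonneg (mul_nonneg zero_le_two (hpos _ _)) (hA_nonneg _ _)
  · intro ya ua ub
    dsimp only
    split_ifs with h
    · simp [hcard]
    · rw [← sum_div, ← mul_sum, hsum]
      field_simp
  · intro ya ua r ub
    dsimp only
    split_ifs with h
    · have hzero : ∑ r, margB W (ya, ua, r) ub = 0 := by rw [hsum, h, zero_div]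
      rw [(sum_eq_zero_iff_of_nonneg fun r _ => hpos _ _).1 hzero r (mem_univ r), h]
      ring
    · field_simp
  · intro ya ua r ub
    dsimp only
    rw [← (hB ya ua r ub).2.1]
  · intro ya ua r ub
    dsimp only
    rw [← (hB ya ua r ub).1, ← hA]
end

section
/- Let W_b be a symmetrized joint channel (successive form, D-value representation) with decoupling decomposition W_2 and upgrade-couple channel Ŵ_b, with splitting factors S_{i,j} and α_{i,j}(y_a) = S_{i,j}(y_a,0,d_{bi})·S_{i,j}(y_a,1,d_{bj}). Then: (1) Σ_{i,j} Ŵ_b(y_a^{i,j},u_a,d_b|u_b) = W_b(y_a,u_a,d_b|u_b) for all y_a,u_a,d_b,u_b, so Ŵ_b is properly upgraded from W_b via the proper degrading channel that deterministically maps y_a^{i,j} to y_a; (2) the a-channel marginal satisfies Ŵ_a(y_a^{i,j}|u_a) = W_a(y_a|u_a)·α_{i,j}(y_a), and whenever α_{i,j}(y_a) > 0, the a-channel D-value of y_a^{i,j} under Ŵ_a equals the a-channel D-value of y_a under W_a; (3) whenever Ŵ_a(y_a^{i,j}|u_a) > 0, the channel Ŵ_2(d_b|u_b;y_a^{i,j},u_a)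 = Ŵ_b(y_a^{i,j},u_a,d_b|u_b)/((1/2)·Ŵ_a(y_a^{i,j}|u_a)) is a binary symmetric channel: for u_a = 0 it outputs only ±d_{bi} with Ŵ_2(±d_{bi}|u_b) = (1 ± (−1)^{u_b} d_{bi})/2, and for u_a = 1 it outputs only ±d_{bj} with Ŵ_2(±d_{bj}|u_b) = (1 ± (−1)^{u_b} d_{bj})/2. -/
open Finset

/-- The real value of a signed D-value symbol: `(s, i)` stands for `+d_{bi}` if `s = false`
and `−d_{bi}` if `s = true`. -/
noncomputable def vD {B : ℕ} (dB : Fin B → ℝ) : Bool × Fin B → ℝ :=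
  fun r => if r.1 then -dB r.2 else dB r.2

/-- Negation (conjugation) of a signed D-value symbol. -/
def negD {B : ℕ} : Bool × Fin B → Bool × Fin B := fun r => (!r.1, r.2)

/-- The splitting factor `S_{i,j}(y_a, u_a, d_b)` of the upgrade-couple transform. -/
noncomputable def Sfac {Ya : Type*} {B : ℕ}
    (W2 : Bool × Fin B → Bool → Ya → Bool → ℝ)
    (i j : Fin B) (ya : Ya) (ua : Bool) (r : Bool × Fin B) : ℝ :=
  if ua = false then
    (if r.2 = i then ∑ ub, W2 (false, j) ub ya true else 0)
  else
    (if r.2 = j then ∑ ub, W2 (false, i) ub ya false else 0)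

/-- `α_{i,j}(y_a) = S_{i,j}(y_a,0,d_{bi}) · S_{i,j}(y_a,1,d_{bj})`. -/
noncomputable def alphaFac {Ya : Type*} {B : ℕ}
    (W2 : Bool × Fin B → Bool → Ya → Bool → ℝ) (i j : Fin B) (ya : Ya) : ℝ :=
  Sfac W2 i j ya false (false, i) * Sfac W2 i j ya true (false, j)

/-- The upgrade-couple joint channel `Ŵ_{a,b}`, in successive form, with a-outputs
`y_a^{i,j} = (y_a, i, j)` and b-marginal
`Ŵ_b(y_a^{i,j}, u_a, d_b | u_b) = W_b(y_a, u_a, d_b | u_b) · S_{i,j}(y_a, u_a, d_b)`. -/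
noncomputable def upgradeCouple {Ya : Type*} [Fintype Ya] [DecidableEq Ya] {B : ℕ}
    (W : Ya → Ya × Bool × (Bool × Fin B) → Bool → Bool → ℝ)
    (W2 : Bool × Fin B → Bool → Ya → Bool → ℝ) :
    Ya × Fin B × Fin B →
      (Ya × Fin B × Fin B) × Bool × (Bool × Fin B) → Bool → Bool → ℝ :=
  fun p q ua ub =>
    if q.1 = p ∧ q.2.1 = ua then
      2 * (margB W (p.1, ua, q.2.2) ub * Sfac W2 p.2.1 p.2.2 p.1 ua q.2.2)
    else 0

/-- Total weight `∑_{u_b} W_2(d_{bk}|u_b; y_a, u_a)` of the `D`-value magnitude with index `k`. -/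
noncomputable def magWeight {Ya : Type*} {B : ℕ}
    (W2 : Bool × Fin B → Bool → Ya → Bool → ℝ) (k : Fin B) (ya : Ya) (ua : Bool) : ℝ :=
  ∑ ub, W2 (false, k) ub ya ua

section

variable {Ya : Type*} {B : ℕ} {W2 : Bool × Fin B → Bool → Ya → Bool → ℝ}

theorem Sfac_eq (i j : Fin B) (ya : Ya) (ua : Bool) (r : Bool × Fin B) :
    Sfac W2 i j ya ua r =
      if r.2 = (if ua = true then j else i) then
        magWeight W2 (if ua = true then i else j) ya (!ua) else 0 := by
  cases ua <;> simp [Sfac, magWeight]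

theorem alphaFac_eq (i j : Fin B) (ya : Ya) (ua : Bool) :
    alphaFac W2 i j ya =
      magWeight W2 (if ua = true then j else i) ya ua *
        magWeight W2 (if ua = true then i else j) ya (!ua) := by
  cases ua <;> simp [alphaFac, Sfac_eq, mul_comm]

/-- Both signs of a `D`-value carry the same total weight. -/
theorem sum_input_eq_magWeight
    (hneg : ∀ r ub ya ua, W2 (negD r) (!ub) ya ua = W2 r ub ya ua)
    (r : Bool × Fin B) (ya : Ya) (ua : Bool) :
    W2 r false ya ua + W2 r true ya ua = magWeight W2 r.2 ya ua := by
  obtain ⟨s, k⟩ := r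
  have hf := hneg (false, k) false ya ua
  have ht := hneg (false, k) true ya ua
  simp only [negD, Bool.not_false, Bool.not_true] at hf ht
  cases s <;> simp only [magWeight, Fintype.sum_bool] <;> linarith

theorem magWeight_nonneg (hW2 : ∀ r ub ya ua, 0 ≤ W2 r ub ya ua)
    (k : Fin B) (ya : Ya) (ua : Bool) : 0 ≤ magWeight W2 k ya ua :=
  Finset.sum_nonneg fun _ _ => hW2 _ _ _ _

theorem sum_magWeight (hneg : ∀ r ub ya ua, W2 (negD r) (!ub) ya ua = W2 r ub ya ua)
    (hsum : ∀ ya ua ub, ∑ r, W2 r ub ya ua = 1) (ya : Ya) (ua : Bool) :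
    ∑ k, magWeight W2 k ya ua = 1 := by
  rw [← hsum ya ua false, Fintype.sum_prod_type, Fintype.sum_bool, ← Finset.sum_add_distrib]
  refine Finset.sum_congr rfl fun k _ => ?_
  have ht := hneg (false, k) true ya ua
  simp only [negD, Bool.not_false, Bool.not_true] at ht
  simp only [magWeight, Fintype.sum_bool]
  linarith

theorem sum_Sfac (hneg : ∀ r ub ya ua, W2 (negD r) (!ub) ya ua = W2 r ub ya ua)
    (hsum : ∀ ya ua ub, ∑ r, W2 r ub ya ua = 1) (ya : Ya) (ua : Bool) (r : Bool × Fin B) :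
    ∑ i, ∑ j, Sfac W2 i j ya ua r = 1 := by
  cases ua
  · rw [Finset.sum_comm]
    simp [Sfac_eq, sum_magWeight hneg hsum]
  · simp [Sfac_eq, sum_magWeight hneg hsum]

variable [Fintype Ya]

theorem margA_nonneg {Yb : Type*} [Fintype Yb] {W : Ya → Yb → Bool → Bool → ℝ}
    (hW : IsJointChannel W) (ya : Ya) (ua : Bool) : 0 ≤ margA W ya ua :=
  mul_nonneg (by norm_num)
    (Finset.sum_nonneg fun _ _ => Finset.sum_nonneg fun _ _ => hW.1 _ _ _ _)

/-- In a `D`-value representation, the decoupled channel is determined by the `D`-values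
and the weights of their magnitudes. -/
theorem W2_eq_of_margA_pos {W : Ya → Ya × Bool × (Bool × Fin B) → Bool → Bool → ℝ}
    {dB : Fin B → ℝ} (hrep : DvalRepJoint W (vD dB)) (hdec : DecouplingDecomp W W2)
    (hneg : ∀ r ub ya ua, W2 (negD r) (!ub) ya ua = W2 r ub ya ua)
    {ya : Ya} {ua : Bool} {r : Bool × Fin B}
    (hA : 0 < margA W ya ua) (hk : 0 < magWeight W2 r.2 ya ua) (ub : Bool) :
    W2 r ub ya ua =
      (1 + (if xor r.1 ub = true then (-1 : ℝ) else 1) * dB r.2) / 2 *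
        magWeight W2 r.2 ya ua := by
  have hs := sum_input_eq_magWeight hneg r ya ua
  have htot : margB W (ya, ua, r) false + margB W (ya, ua, r) true =
      1 / 2 * margA W ya ua * magWeight W2 r.2 ya ua := by
    rw [hdec.2.2, hdec.2.2, ← hs]; ring
  have hpos : 0 < 1 / 2 * margA W ya ua * magWeight W2 r.2 ya ua := by positivity
  have hv := hrep ya ua r (htot ▸ hpos)
  rw [dval, htot, eq_div_iff hpos.ne', hdec.2.2, hdec.2.2] at hv
  have hd : vD dB r * magWeight W2 r.2 ya ua = W2 r false ya ua - W2 r true ya ua := by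
    refine mul_left_cancel₀ (show 1 / 2 * margA W ya ua ≠ 0 by positivity) ?_
    linear_combination hv
  obtain ⟨s, k⟩ := r
  cases s <;> cases ub <;> simp [vD] at hd hs ⊢ <;> linarith

variable [DecidableEq Ya] (W : Ya → Ya × Bool × (Bool × Fin B) → Bool → Bool → ℝ)

theorem margB_upgradeCouple (p : Ya × Fin B × Fin B) (ua : Bool) (r : Bool × Fin B) (ub : Bool) :
    margB (upgradeCouple W W2) (p, ua, r) ub =
      margB W (p.1, ua, r) ub * Sfac W2 p.2.1 p.2.2 p.1 ua r := by
  rw [margB]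
  simp only [upgradeCouple, ite_and, Finset.sum_ite_eq, Finset.mem_univ, if_true]
  ring

theorem margA_upgradeCouple (hdec : DecouplingDecomp W W2)
    (hneg : ∀ r ub ya ua, W2 (negD r) (!ub) ya ua = W2 r ub ya ua)
    (ya : Ya) (i j : Fin B) (ua : Bool) :
    margA (upgradeCouple W W2) (ya, i, j) ua = margA W ya ua * alphaFac W2 i j ya := by
  have hsum : margA (upgradeCouple W W2) (ya, i, j) ua =
      ∑ r, ∑ ub, margB W (ya, ua, r) ub * Sfac W2 i j ya ua r := by
    rw [margA, Finset.sum_comm, mul_sum,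
      Fintype.sum_prod_type, Finset.sum_eq_single (ya, i, j)]
    · rw [Fintype.sum_prod_type, Finset.sum_eq_single ua]
      · simp [upgradeCouple, mul_add]
      · simp +contextual [upgradeCouple]
      · simp
    · simp +contextual [upgradeCouple]
    · simp
  have hr : ∀ r, ∑ ub, margB W (ya, ua, r) ub * Sfac W2 i j ya ua r =
      1 / 2 * margA W ya ua * magWeight W2 r.2 ya ua * Sfac W2 i j ya ua r := by
    intro r
    rw [← sum_input_eq_magWeight hneg r, Fintype.sum_bool, hdec.2.2, hdec.2.2]
    ring
  rw [hsum, alphaFac_eq i j ya ua, Finset.sum_congr rfl fun r _ => hr r, Fintype.sum_prod_type]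
  simp only [Sfac_eq, mul_ite, mul_zero, Finset.sum_ite_eq', Finset.mem_univ, if_true,
    Fintype.sum_bool]
  ring

end

/-- Properties of the upgrade-couple channel `Ŵ = upgradeCouple W W2`:
(1) summing over the classes recovers `W_b`, and `Ŵ ≽p W`;
(2) `Ŵ_a(y_a^{i,j}|u_a) = W_a(y_a|u_a)·α_{i,j}(y_a)`, and whenever `α_{i,j}(y_a) > 0` the
a-channel D-value of `y_a^{i,j}` equals that of `y_a`;
(3) whenever `Ŵ_a(y_a^{i,j}|u_a) > 0`, the conditional channel
`Ŵ_2(d_b|u_b; y_a^{i,j}, u_a)` is the BSC on `±d_{bi}` (for `u_a = 0`) resp. `±d_{bj}`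
(for `u_a = 1`) with `Ŵ_2(±d) = (1 ± (−1)^{u_b} d)/2`. -/
theorem stmt15 {Ya : Type*} [Fintype Ya] [DecidableEq Ya] {B : ℕ}
    (W : Ya → Ya × Bool × (Bool × Fin B) → Bool → Bool → ℝ)
    (dB : Fin B → ℝ) (bar : Ya → Ya)
    (hW : IsJointChannel W) (hsucc : SuccessiveForm W)
    (hdB0 : ∀ i, 0 ≤ dB i) (hdBmono : Monotone dB)
    (hrep : DvalRepJoint W (vD dB))
    (hsym : SymmetrizedJoint W (vD dB) bar negD)
    (W2 : Bool × Fin B → Bool → Ya → Bool → ℝ)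
    (hdec : DecouplingDecomp W W2)
    (hW2neg : ∀ r ub ya ua, W2 (negD r) (!ub) ya ua = W2 r ub ya ua)
    (hW2bar : ∀ r ub ya ua, W2 r ub (bar ya) (!ua) = W2 r ub ya ua) :
    (∀ ya ua r ub,
      (∑ i, ∑ j, margB (upgradeCouple W W2) ((ya, i, j), ua, r) ub) =
        margB W (ya, ua, r) ub) ∧
    ProperUpgrade (upgradeCouple W W2) W ∧
    (∀ ya (i j : Fin B) ua,
      margA (upgradeCouple W W2) (ya, i, j) ua =
        margA W ya ua * alphaFac W2 i j ya) ∧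
    (∀ ya (i j : Fin B), 0 < alphaFac W2 i j ya →
      dval (margA (upgradeCouple W W2)) (ya, i, j) = dval (margA W) ya) ∧
    (∀ ya (i j : Fin B) ua, 0 < margA (upgradeCouple W W2) (ya, i, j) ua →
      ∀ r ub,
        margB (upgradeCouple W W2) ((ya, i, j), ua, r) ub /
            ((1 / 2) * margA (upgradeCouple W W2) (ya, i, j) ua) =
          if r.2 = (if ua = true then j else i) then
            (1 + (if xor r.1 ub = true then (-1 : ℝ) else 1) *
              dB (if ua = true then j else i)) / 2
          else 0) := by
  have hB := margB_upgradeCouple (W2 := W2) W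
  have hA := margA_upgradeCouple W hdec hW2neg
  have hcouple : ∀ ya ua r ub,
      (∑ i, ∑ j, margB (upgradeCouple W W2) ((ya, i, j), ua, r) ub) =
        margB W (ya, ua, r) ub := by
    intro ya ua r ub
    simp only [hB, ← Finset.mul_sum]
    rw [sum_Sfac hW2neg hdec.2.1, mul_one]
  refine ⟨hcouple, ?_, hA, ?_, ?_⟩
  · refine ⟨fun z y => if z.1 = y then 1 else 0, fun _ _ zr _ yr => if zr = yr then 1 else 0,
      fun _ _ => by positivity, fun _ => by simp, fun _ _ _ _ _ => by positivity,
      fun _ _ _ _ => by simp, fun ya ua yr ub => ?_⟩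
    rw [← hcouple]
    simp only [ite_mul, one_mul, zero_mul]
    rw [Fintype.sum_prod_type, Finset.sum_eq_single ya] <;>
      simp +contextual [Fintype.sum_prod_type]
  · intro ya i j hα
    rw [dval, dval, hA, hA, ← sub_mul, ← add_mul, mul_div_mul_right _ _ hα.ne']
  · intro ya i j ua hpos r ub
    rw [hA] at hpos
    have hWa : 0 < margA W ya ua :=
      (margA_nonneg hW ya ua).lt_of_ne' (left_ne_zero_of_mul hpos.ne')
    have hα := right_ne_zero_of_mul hpos.ne'
    rw [alphaFac_eq i j ya ua] at hα
    have hk := (magWeight_nonneg hdec.1 _ _ _).lt_of_ne' (left_ne_zero_of_mul hα)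
    have hk' := right_ne_zero_of_mul hα
    rw [hB, hA, Sfac_eq, alphaFac_eq i j ya ua, hdec.2.2]
    dsimp only at hk hk' ⊢
    generalize (if ua = true then j else i) = k at hk ⊢
    generalize (if ua = true then i else j) = k' at hk' ⊢
    by_cases hr : r.2 = k
    · subst hr
      rw [if_pos rfl, if_pos rfl, W2_eq_of_margA_pos hrep hdec hW2neg hWa hk]
      field_simp
    · rw [if_neg hr, if_neg hr, mul_zero, zero_div]
end
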